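/- arXiv:hep-th/9610039 — 9 statements merged into one kernel-verified Lean document; each statement's English description precedes it below -/
import Mathlib

section
/- The monodromy matrix built from the rational R-matrix satisfies the RTT relation: for all u, v ∈ ℂ, R₁₂(u−v) ∘ 𝒯₁₃(u) ∘ 𝒯₂₃(v) = 𝒯₂₃(v) ∘ 𝒯₁₃(u) ∘ R₁₂(u−v) as endomorphisms of V₁ ⊗ V₂ ⊗ W, where V₁ = V₂ = V are two auxiliary copies, R₁₂(u) acts on V₁ ⊗ V₂ and as the identity on W, and 𝒯ᵢ₃(u) denotes the monodromy matrix acting in the i-th auxiliary space and the quantum space W. -/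
noncomputable section

/-- The permutation matrix `P` on `ℂ^k ⊗ ℂ^k` (basis indexed by `Fin k × Fin k`):
`P (e_c ⊗ e_d) = e_d ⊗ e_c`. -/
def Pm (k : ℕ) : Matrix (Fin k × Fin k) (Fin k × Fin k) ℂ :=
  fun p q => if p.1 = q.2 ∧ p.2 = q.1 then 1 else 0

/-- The rational R-matrix `R(u) = u • id + 2 • P` on `ℂ^k ⊗ ℂ^k`. -/
noncomputable def Rm (k : ℕ) (u : ℂ) : Matrix (Fin k × Fin k) (Fin k × Fin k) ℂ :=
  u • (1 : Matrix (Fin k × Fin k) (Fin k × Fin k) ℂ) + (2 : ℂ) • Pm k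

/-- Basis index of the space `V₀ ⊗ W`, `V₀ = ℂ^k`, `W = (ℂ^k)^{⊗N}`. -/
abbrev AuxQ (k N : ℕ) := Fin k × (Fin N → Fin k)

/-- `R₀ⱼ(u)`: the R-matrix acting on the auxiliary factor `V₀` and the `j`-th
tensor factor of the quantum space `W`, identity elsewhere. -/
noncomputable def R0j (k N : ℕ) (u : ℂ) (j : Fin N) : Matrix (AuxQ k N) (AuxQ k N) ℂ :=
  fun p q => Rm k u (p.1, p.2 j) (q.1, q.2 j) *
    (if ∀ i : Fin N, i ≠ j → p.2 i = q.2 i then 1 else 0)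

/-- The monodromy matrix `𝒯(u) = R₀N(u−y_N) ⋯ R₀₂(u−y₂) R₀₁(u−y₁)` on `V₀ ⊗ W`. -/
noncomputable def mono (k N : ℕ) (y : Fin N → ℂ) (u : ℂ) : Matrix (AuxQ k N) (AuxQ k N) ℂ :=
  ((List.ofFn (fun j : Fin N => R0j k N (u - y j) j)).reverse).prod

/-- Basis index of `V₁ ⊗ V₂ ⊗ W`. -/
abbrev AAQ (k N : ℕ) := Fin k × Fin k × (Fin N → Fin k)

/-- `𝒯₁₃(u)`: monodromy matrix acting in the first auxiliary space and the quantum space. -/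
noncomputable def T13 (k N : ℕ) (y : Fin N → ℂ) (u : ℂ) : Matrix (AAQ k N) (AAQ k N) ℂ :=
  fun p q => mono k N y u (p.1, p.2.2) (q.1, q.2.2) * (if p.2.1 = q.2.1 then 1 else 0)

/-- `𝒯₂₃(u)`: monodromy matrix acting in the second auxiliary space and the quantum space. -/
noncomputable def T23 (k N : ℕ) (y : Fin N → ℂ) (u : ℂ) : Matrix (AAQ k N) (AAQ k N) ℂ :=
  fun p q => mono k N y u (p.2.1, p.2.2) (q.2.1, q.2.2) * (if p.1 = q.1 then 1 else 0)

/-- `R₁₂(u)`: the R-matrix acting on the two auxiliary spaces, identity on `W`. -/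
noncomputable def R12e (k N : ℕ) (u : ℂ) : Matrix (AAQ k N) (AAQ k N) ℂ :=
  fun p q => Rm k u (p.1, p.2.1) (q.1, q.2.1) * (if p.2.2 = q.2.2 then 1 else 0)

/-- In a monoid, exchange relations `r aᵢ bᵢ = bᵢ aᵢ r` for the factors yield the exchange relation
for ordered products, as soon as `aᵢ` and `bⱼ` commute for `i ≠ j`. -/
theorem mul_prod_mul_prod_exchange {M ι : Type*} [Monoid M] (r : M) (a b : ι → M)
    (hr : ∀ i, r * a i * b i = b i * a i * r) (hab : ∀ i j, i ≠ j → Commute (a i) (b j))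
    (l : List ι) (hl : l.Nodup) :
    r * (l.map a).prod * (l.map b).prod = (l.map b).prod * (l.map a).prod * r := by
  induction l with
  | nil => simp
  | cons i t ih =>
    obtain ⟨hi, ht⟩ := List.nodup_cons.mp hl
    have hA : Commute (t.map a).prod (b i) := Commute.list_prod_left _ _ fun x hx => by
      obtain ⟨j, hj, rfl⟩ := List.mem_map.mp hx
      exact hab j i fun h => hi (h ▸ hj)
    have hB : Commute (a i) (t.map b).prod := Commute.list_prod_right _ _ fun x hx => by
      obtain ⟨j, hj, rfl⟩ := List.mem_map.mp hx
      exact hab i j fun h => hi (h ▸ hj)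
    simp only [List.map_cons, List.prod_cons]
    calc r * (a i * (t.map a).prod) * (b i * (t.map b).prod)
        = r * a i * ((t.map a).prod * b i) * (t.map b).prod := by simp only [mul_assoc]
      _ = (r * a i * b i) * (t.map a).prod * (t.map b).prod := by
        rw [hA.eq]; simp only [mul_assoc]
      _ = b i * a i * (r * (t.map a).prod * (t.map b).prod) := by
        rw [hr]; simp only [mul_assoc]
      _ = b i * (a i * (t.map b).prod) * (t.map a).prod * r := by
        rw [ih ht]; simp only [mul_assoc]
      _ = b i * (t.map b).prod * (a i * (t.map a).prod) * r := by
        rw [hB.eq]; simp only [mul_assoc]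

/-- The Yang–Baxter equation with spectral parameter, for elements `a`, `b`, `c` of an algebra
that multiply like the transpositions `(1 2)`, `(1 3)`, `(2 3)`. -/
theorem yang_baxter_of_transposition_relations {K A : Type*} [CommRing K] [Ring A] [Algebra K A]
    (a b c : A) (t x y : K) (h₁ : a * b = c * a) (h₂ : b * c = c * a)
    (h₃ : b * a = a * c) (h₄ : c * b = a * c) :
    ((x - y) • 1 + t • a) * (x • 1 + t • b) * (y • 1 + t • c) =
      (y • 1 + t • c) * (x • 1 + t • b) * ((x - y) • 1 + t • a) := by
  have h₅ : a * b * c = c * b * a := by rw [h₁, mul_assoc, ← h₃, mul_assoc]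
  have h₆ : c * a * c = a * c * a := by rw [← h₁, h₅, h₄]
  simp only [add_mul, mul_add, smul_mul_assoc, mul_smul_comm, one_mul, mul_one, smul_add,
    smul_smul, h₁, h₂, h₃, h₄, h₆]
  module

/-- The exchange of the two auxiliary indices. -/
def swapAux (k N : ℕ) : Equiv.Perm (AAQ k N) :=
  Function.Involutive.toPerm (fun p => (p.2.1, p.1, p.2.2)) fun _ => rfl

/-- The exchange of the first auxiliary index with the `j`-th quantum index. -/
def swapFst (k N : ℕ) (j : Fin N) : Equiv.Perm (AAQ k N) :=
  Function.Involutive.toPerm (fun p => (p.2.2 j, p.2.1, Function.update p.2.2 j p.1))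
    fun p => by simp

/-- The exchange of the second auxiliary index with the `j`-th quantum index. -/
def swapSnd (k N : ℕ) (j : Fin N) : Equiv.Perm (AAQ k N) :=
  Function.Involutive.toPerm (fun p => (p.1, p.2.2 j, Function.update p.2.2 j p.2.1))
    fun p => by simp

theorem swapAux_apply (k N : ℕ) (p : AAQ k N) : swapAux k N p = (p.2.1, p.1, p.2.2) := rfl

theorem swapFst_apply (k N : ℕ) (j : Fin N) (p : AAQ k N) :
    swapFst k N j p = (p.2.2 j, p.2.1, Function.update p.2.2 j p.1) := rfl

theorem swapSnd_apply (k N : ℕ) (j : Fin N) (p : AAQ k N) :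
    swapSnd k N j p = (p.1, p.2.2 j, Function.update p.2.2 j p.2.1) := rfl

theorem swapFst_mul_swapAux (k N : ℕ) (j : Fin N) :
    swapFst k N j * swapAux k N = swapAux k N * swapSnd k N j := by
  ext1 p
  simp [swapAux_apply, swapFst_apply, swapSnd_apply]

theorem swapSnd_mul_swapFst (k N : ℕ) (j : Fin N) :
    swapSnd k N j * swapFst k N j = swapAux k N * swapSnd k N j := by
  ext1 p
  simp [swapAux_apply, swapFst_apply, swapSnd_apply]

theorem swapAux_mul_swapFst (k N : ℕ) (j : Fin N) :
    swapAux k N * swapFst k N j = swapSnd k N j * swapAux k N := by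
  ext1 p
  simp [swapAux_apply, swapFst_apply, swapSnd_apply]

theorem swapFst_mul_swapSnd (k N : ℕ) (j : Fin N) :
    swapFst k N j * swapSnd k N j = swapSnd k N j * swapAux k N := by
  ext1 p
  simp [swapAux_apply, swapFst_apply, swapSnd_apply]

theorem commute_swapFst_swapSnd (k N : ℕ) {i j : Fin N} (h : i ≠ j) :
    Commute (swapFst k N i) (swapSnd k N j) := by
  ext1 p
  simp [swapFst_apply, swapSnd_apply, h, h.symm, Function.update_comm h]

/-- Extension of a matrix on `V₀ ⊗ W` to `V₁ ⊗ V₂ ⊗ W`, acting on the second auxiliary space. -/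
def actSnd (k N : ℕ) : Matrix (AuxQ k N) (AuxQ k N) ℂ →* Matrix (AAQ k N) (AAQ k N) ℂ where
  toFun A := Matrix.kronecker 1 A
  map_one' := Matrix.one_kronecker_one
  map_mul' A B := by simp [← Matrix.mul_kronecker_mul]

/-- Extension of a matrix on `V₀ ⊗ W` to `V₁ ⊗ V₂ ⊗ W`, acting on the first auxiliary space. -/
def actFst (k N : ℕ) : Matrix (AuxQ k N) (AuxQ k N) ℂ →* Matrix (AAQ k N) (AAQ k N) ℂ :=
  (Matrix.reindexAlgEquiv ℂ ℂ (swapAux k N) : _ →* _).comp (actSnd k N)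

theorem actSnd_apply (k N : ℕ) (A : Matrix (AuxQ k N) (AuxQ k N) ℂ) (p q : AAQ k N) :
    actSnd k N A p q = A (p.2.1, p.2.2) (q.2.1, q.2.2) * (if p.1 = q.1 then 1 else 0) := by
  simp [actSnd, Matrix.one_apply]

theorem actFst_apply (k N : ℕ) (A : Matrix (AuxQ k N) (AuxQ k N) ℂ) (p q : AAQ k N) :
    actFst k N A p q = A (p.1, p.2.2) (q.1, q.2.2) * (if p.2.1 = q.2.1 then 1 else 0) :=
  actSnd_apply k N A _ _

theorem mono_eq_prod_map (k N : ℕ) (y : Fin N → ℂ) (u : ℂ) :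
    mono k N y u = ((List.finRange N).reverse.map fun j => R0j k N (u - y j) j).prod := by
  rw [mono, List.ofFn_eq_map, List.map_reverse]

theorem T13_eq_prod_map (k N : ℕ) (y : Fin N → ℂ) (u : ℂ) :
    T13 k N y u =
      ((List.finRange N).reverse.map fun j => actFst k N (R0j k N (u - y j) j)).prod := by
  trans actFst k N (mono k N y u)
  · ext p q
    rw [actFst_apply, T13]
  · rw [mono_eq_prod_map, map_list_prod, List.map_map]
    rfl

theorem T23_eq_prod_map (k N : ℕ) (y : Fin N → ℂ) (u : ℂ) :
    T23 k N y u =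
      ((List.finRange N).reverse.map fun j => actSnd k N (R0j k N (u - y j) j)).prod := by
  trans actSnd k N (mono k N y u)
  · ext p q
    rw [actSnd_apply, T23]
  · rw [mono_eq_prod_map, map_list_prod, List.map_map]
    rfl

theorem R0j_apply (k N : ℕ) (u : ℂ) (j : Fin N) (p q : AuxQ k N) :
    R0j k N u j p q = (if p = q then u else 0) +
      (if (p.2 j, Function.update p.2 j p.1) = q then 2 else 0) := by
  obtain ⟨a, w⟩ := p
  obtain ⟨b, z⟩ := q
  have h₁ : w = z ↔ w j = z j ∧ ∀ i, i ≠ j → w i = z i := by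
    simpa using Function.update_eq_iff (a := j) (b := w j) (f := w) (g := z)
  simp only [R0j, Rm, Pm, Matrix.add_apply, Matrix.smul_apply, Matrix.one_apply, smul_eq_mul,
    Prod.mk.injEq, Function.update_eq_iff, h₁]
  grind

theorem R12e_eq (k N : ℕ) (u : ℂ) :
    R12e k N u = u • 1 + (2 : ℂ) • (swapAux k N).permMatrix ℂ := by
  ext ⟨a, b, w⟩ ⟨c, d, z⟩
  simp only [R12e, Rm, Pm, Matrix.add_apply, Matrix.smul_apply, Matrix.one_apply, smul_eq_mul,
    Prod.mk.injEq, PEquiv.toMatrix_apply, Equiv.toPEquiv_apply, Option.mem_some_iff, swapAux_apply]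
  grind

theorem actFst_R0j (k N : ℕ) (u : ℂ) (j : Fin N) :
    actFst k N (R0j k N u j) = u • 1 + (2 : ℂ) • (swapFst k N j).permMatrix ℂ := by
  ext ⟨a, b, w⟩ ⟨c, d, z⟩
  simp only [actFst_apply, R0j_apply, Matrix.add_apply, Matrix.smul_apply, Matrix.one_apply,
    smul_eq_mul, Prod.mk.injEq, PEquiv.toMatrix_apply, Equiv.toPEquiv_apply, Option.mem_some_iff,
    swapFst_apply]
  grind

theorem actSnd_R0j (k N : ℕ) (u : ℂ) (j : Fin N) :
    actSnd k N (R0j k N u j) = u • 1 + (2 : ℂ) • (swapSnd k N j).permMatrix ℂ := by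
  ext ⟨a, b, w⟩ ⟨c, d, z⟩
  simp only [actSnd_apply, R0j_apply, Matrix.add_apply, Matrix.smul_apply, Matrix.one_apply,
    smul_eq_mul, Prod.mk.injEq, PEquiv.toMatrix_apply, Equiv.toPEquiv_apply, Option.mem_some_iff,
    swapSnd_apply]
  grind

/-- the RTT relation
`R₁₂(u−v) 𝒯₁₃(u) 𝒯₂₃(v) = 𝒯₂₃(v) 𝒯₁₃(u) R₁₂(u−v)` on `V₁ ⊗ V₂ ⊗ W`. -/
theorem RTT_relation (k N : ℕ) (hk : 1 ≤ k) (hN : 1 ≤ N) (y : Fin N → ℂ) (u v : ℂ) :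
    R12e k N (u - v) * T13 k N y u * T23 k N y v =
      T23 k N y v * T13 k N y u * R12e k N (u - v) := by
  rw [T13_eq_prod_map, T23_eq_prod_map]
  refine mul_prod_mul_prod_exchange _ _ _ (fun j => ?_) (fun i j hij => ?_) _
    (List.nodup_reverse.mpr (List.nodup_finRange N))
  · have h := yang_baxter_of_transposition_relations ((swapAux k N).permMatrix ℂ)
      ((swapFst k N j).permMatrix ℂ) ((swapSnd k N j).permMatrix ℂ) (2 : ℂ) (u - y j) (v - y j)
      (by simp only [← Matrix.permMatrix_mul, swapFst_mul_swapAux])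
      (by simp only [← Matrix.permMatrix_mul, swapSnd_mul_swapFst])
      (by simp only [← Matrix.permMatrix_mul, swapAux_mul_swapFst])
      (by simp only [← Matrix.permMatrix_mul, swapFst_mul_swapSnd])
    rw [sub_sub_sub_cancel_right] at h
    rw [R12e_eq, actFst_R0j, actSnd_R0j, h]
  · have h : Commute ((swapFst k N i).permMatrix ℂ) ((swapSnd k N j).permMatrix ℂ) := by
      rw [Commute, SemiconjBy, ← Matrix.permMatrix_mul, ← Matrix.permMatrix_mul,
        (commute_swapFst_swapSnd k N hij).eq]
    rw [actFst_R0j, actSnd_R0j]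
    exact .add_left ((Commute.one_left _).smul_left _)
      (.add_right ((Commute.one_right _).smul_right _) ((h.smul_left _).smul_right _))

end
end

section
/- The quantum transfer matrices built from the rational R-matrix commute: for all u, v ∈ ℂ, t(u) ∘ t(v) = t(v) ∘ t(u) as endomorphisms of the quantum space W, where t(u) ∈ End(W) is the partial trace over the auxiliary space V₀ of the monodromy matrix 𝒯(u) ∈ End(V₀ ⊗ W). -/
noncomputable section

/-- The transfer matrix `t(u)`: the partial trace of the monodromy matrix `𝒯(u)`
over the auxiliary space `V₀`. -/
noncomputable def transfer (k N : ℕ) (y : Fin N → ℂ) (u : ℂ) :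
    Matrix (Fin N → Fin k) (Fin N → Fin k) ℂ :=
  fun f g => ∑ a : Fin k, mono k N y u (a, f) (a, g)

namespace RTT

section Abstract

variable {K A n : Type*} [CommRing K] [Ring A] [Algebra K A]

/-- The exchange relation `R₁₂ T₁ T'₂ = T'₂ T₁ R₁₂` for the rational R-matrix
`R = w • 1 + c • P`, written in matrix entries. -/
def Exchange (w c : K) (T T' : Matrix n n A) : Prop :=
  ∀ i j k l, w • (T i j * T' k l) + c • (T k j * T' i l) =
    w • (T' k l * T i j) + c • (T' k j * T i l)

theorem Exchange.one [DecidableEq n] (w c : K) :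
    Exchange w c (1 : Matrix n n A) (1 : Matrix n n A) := by
  intro i j k l
  simp only [Matrix.one_apply]
  split_ifs <;> simp

variable [Fintype n]

/-- The exchange relation is compatible with products of matrices with mutually commuting
entries. -/
theorem Exchange.mul {w c : K} {L L' M M' : Matrix n n A}
    (hL : Exchange w c L L') (hM : Exchange w c M M')
    (hLM : ∀ i j k l, Commute (L i j) (M' k l)) (hLM' : ∀ i j k l, Commute (L' i j) (M k l)) :
    Exchange w c (L * M) (L' * M') := by
  have expand : ∀ i j k l, (L * M) i j * (L' * M') k l =
      ∑ e, ∑ f, L i e * L' k f * (M e j * M' f l) := by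
    intro i j k l
    simp only [Matrix.mul_apply, Finset.sum_mul_sum]
    refine Finset.sum_congr rfl fun e _ => Finset.sum_congr rfl fun f _ => ?_
    rw [mul_assoc, ← mul_assoc (M e j), ← (hLM' k f e j).eq]
    simp only [mul_assoc]
  have expand' : ∀ i j k l, (L' * M') k l * (L * M) i j =
      ∑ e, ∑ f, L' k f * L i e * (M' f l * M e j) := by
    intro i j k l
    simp only [Matrix.mul_apply, Finset.sum_mul_sum]
    rw [Finset.sum_comm]
    refine Finset.sum_congr rfl fun e _ => Finset.sum_congr rfl fun f _ => ?_
    rw [mul_assoc, ← mul_assoc (M' f l), ← (hLM i e f l).eq]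
    simp only [mul_assoc]
  intro i j k l
  have h₁ : w • (∑ e, ∑ f, L i e * L' k f * (M e j * M' f l)) +
        c • (∑ e, ∑ f, L k e * L' i f * (M e j * M' f l)) =
      w • (∑ e, ∑ f, L' k f * L i e * (M e j * M' f l)) +
        c • (∑ e, ∑ f, L' k e * L i f * (M e j * M' f l)) := by
    simp only [Finset.smul_sum, ← Finset.sum_add_distrib, ← smul_mul_assoc, ← add_mul]
    refine Finset.sum_congr rfl fun e _ => Finset.sum_congr rfl fun f _ => ?_
    simp only [smul_mul_assoc]
    have := congrArg (· * (M e j * M' f l)) (hL i e k f)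
    simpa only [add_mul, smul_mul_assoc] using this
  have h₂ : w • (∑ e, ∑ f, L' k f * L i e * (M e j * M' f l)) +
        c • (∑ e, ∑ f, L' k f * L i e * (M f j * M' e l)) =
      w • (∑ e, ∑ f, L' k f * L i e * (M' f l * M e j)) +
        c • (∑ e, ∑ f, L' k f * L i e * (M' f j * M e l)) := by
    simp only [Finset.smul_sum, ← Finset.sum_add_distrib]
    refine Finset.sum_congr rfl fun e _ => Finset.sum_congr rfl fun f _ => ?_
    have := congrArg (L' k f * L i e * ·) (hM e j f l)
    simpa only [mul_add, mul_smul_comm] using this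
  have h₃ : ∑ e, ∑ f, L' k e * L i f * (M e j * M' f l) =
      ∑ e, ∑ f, L' k f * L i e * (M f j * M' e l) := Finset.sum_comm
  rw [expand, expand, expand', expand', h₁, h₃, h₂]

/-- Matrices subject to the exchange relation in both orders have commuting traces. -/
theorem Exchange.trace_commute {w c : K} {T T' : Matrix n n A} (hw : IsUnit (2 * w))
    (h : Exchange w c T T') (h' : Exchange (-w) c T' T) : Commute T.trace T'.trace := by
  have key : ∀ {w : K} {T T' : Matrix n n A}, Exchange w c T T' →
      w • (T.trace * T'.trace) + c • (T * T').trace =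
        w • (T'.trace * T.trace) + c • (T' * T).trace := by
    intro w T T' h
    have h₁ : T'.trace * T.trace = ∑ i, ∑ k, T' k k * T i i := by
      simp only [Matrix.trace, Matrix.diag_apply, Finset.sum_mul_sum]
      exact Finset.sum_comm
    have h₂ : (T * T').trace = ∑ i, ∑ k, T k i * T' i k := by
      simp only [Matrix.trace, Matrix.diag_apply, Matrix.mul_apply]
      exact Finset.sum_comm
    have h₃ : (T' * T).trace = ∑ i, ∑ k, T' k i * T i k := by
      simp only [Matrix.trace, Matrix.diag_apply, Matrix.mul_apply]
      exact Finset.sum_comm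
    rw [h₁, h₂, h₃]
    simp only [Matrix.trace, Matrix.diag_apply, Finset.sum_mul_sum, Finset.smul_sum,
      ← Finset.sum_add_distrib]
    exact Finset.sum_congr rfl fun i _ => Finset.sum_congr rfl fun k _ => h i i k k
  have e := congrArg₂ (· + ·) (key h) (key h')
  refine hw.smul_left_cancel.mp ?_
  simp only [neg_smul] at e
  rw [← sub_eq_zero] at e ⊢
  rw [← e, two_mul]
  module

/-- Products of matrices with mutually commuting entries over a duplicate-free list inherit the
exchange relation. -/
theorem Exchange.list_prod [DecidableEq n] {ι : Type*} {w c : K} {L L' : ι → Matrix n n A}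
    (hL : ∀ s, Exchange w c (L s) (L' s))
    (hc : ∀ s t, s ≠ t → ∀ i j k l, Commute (L s i j) (L' t k l))
    {l : List ι} (hl : l.Nodup) : Exchange w c (l.map L).prod (l.map L').prod := by
  have commute_prod : ∀ (F : ι → Matrix n n A) (x : A) (m : List ι),
      (∀ t ∈ m, ∀ k l, Commute x (F t k l)) → ∀ k l, Commute x ((m.map F).prod k l) := by
    intro F x m
    induction m with
    | nil =>
      intro _ k l
      simp only [List.map_nil, List.prod_nil, Matrix.one_apply]
      split_ifs
      · exact Commute.one_right x
      · exact Commute.zero_right x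
    | cons t m ih =>
      intro h k l
      simp only [List.map_cons, List.prod_cons, Matrix.mul_apply]
      exact Commute.sum_right _ _ _ fun e _ =>
        (h t List.mem_cons_self k e).mul_right
          (ih (fun t ht => h t (List.mem_cons_of_mem _ ht)) e l)
  induction l with
  | nil => exact Exchange.one w c
  | cons s l ih =>
    obtain ⟨hs, hl⟩ := List.nodup_cons.mp hl
    simp only [List.map_cons, List.prod_cons]
    exact (hL s).mul (ih hl)
      (fun i j => commute_prod L' _ l fun t ht =>
        hc s t (fun h => hs (h ▸ ht)) i j)
      (fun i j => commute_prod L _ l fun t ht k m =>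
        (hc t s (fun h => hs (h ▸ ht)) k m i j).symm)

end Abstract

section SiteOperators

variable {k N : ℕ}

/-- The matrix unit `E_{ab}` acting on the `j`-th tensor factor of `(ℂ^k)^{⊗N}`. -/
def siteUnit (j : Fin N) (a b : Fin k) : Matrix (Fin N → Fin k) (Fin N → Fin k) ℂ :=
  fun f g => if g j = b ∧ f = Function.update g j a then 1 else 0

theorem siteUnit_mul_apply (i j : Fin N) (a b c d : Fin k) (f g : Fin N → Fin k) :
    (siteUnit i a b * siteUnit j c d) f g =
      if g j = d ∧ Function.update g j c i = b ∧
        f = Function.update (Function.update g j c) i a then 1 else 0 := by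
  rw [Matrix.mul_apply, Finset.sum_eq_single (Function.update g j c)]
  · simp only [siteUnit, and_true]
    split_ifs <;> simp_all
  · intro h _ hh
    simp [siteUnit, hh]
  · simp

theorem siteUnit_mul_same (j : Fin N) (a b c d : Fin k) :
    siteUnit j a b * siteUnit j c d = if c = b then siteUnit j a d else 0 := by
  ext f g
  rw [siteUnit_mul_apply]
  by_cases h : c = b <;> simp [h, siteUnit]

theorem siteUnit_commute {i j : Fin N} (hij : i ≠ j) (a b c d : Fin k) :
    Commute (siteUnit i a b) (siteUnit j c d) := by
  ext f g
  rw [siteUnit_mul_apply, siteUnit_mul_apply, Function.update_of_ne hij,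
    Function.update_of_ne hij.symm, Function.update_comm hij]
  congr 1
  grind

/-- The `R`-matrix at site `j`, as a matrix over operators on the quantum space. -/
def lax (k N : ℕ) (u : ℂ) (j : Fin N) :
    Matrix (Fin k) (Fin k) (Matrix (Fin N → Fin k) (Fin N → Fin k) ℂ) :=
  fun a b => (if a = b then u else 0) • 1 + (2 : ℂ) • siteUnit j b a

theorem comp_symm_R0j (u : ℂ) (j : Fin N) :
    (Matrix.compRingEquiv (Fin k) (Fin N → Fin k) ℂ).symm (R0j k N u j) = lax k N u j := by
  ext a b f g
  change R0j k N u j (a, f) (b, g) = _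
  have h₁ : f = g ↔ f j = g j ∧ ∀ i, i ≠ j → f i = g i := by
    grind
  have h₂ : f = Function.update g j b ↔ f j = b ∧ ∀ i, i ≠ j → f i = g i :=
    Function.eq_update_iff
  simp only [R0j, lax, Rm, Pm, siteUnit, Matrix.add_apply, Matrix.smul_apply, Matrix.one_apply,
    smul_eq_mul, Prod.mk.injEq, h₂]
  rw [if_congr h₁ rfl rfl]
  by_cases h : ∀ i, i ≠ j → f i = g i
  · simp only [if_pos h, and_iff_left h, ite_and]
    grind
  · simp [h]

theorem lax_commute (u v : ℂ) {i j : Fin N} (hij : i ≠ j) (a b c d : Fin k) :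
    Commute (lax k N u i a b) (lax k N v j c d) := by
  have h := siteUnit_commute hij b a d c
  exact .add_left (.add_right (((Commute.one_left _).smul_right _).smul_left _)
      (((Commute.one_left _).smul_right _).smul_left _))
    (.add_right (((Commute.one_right _).smul_right _).smul_left _)
      ((h.smul_right _).smul_left _))

theorem lax_exchange (u v : ℂ) (j : Fin N) :
    Exchange (u - v) 2 (lax k N u j) (lax k N v j) := by
  intro a b c d
  simp only [lax, add_mul, mul_add, smul_mul_assoc, mul_smul_comm, one_mul, mul_one,
    siteUnit_mul_same]
  split_ifs <;> (subst_vars; first | module | (exfalso; simp_all))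

/-- The monodromy matrix as a matrix over operators on the quantum space. -/
def monodromy (k N : ℕ) (y : Fin N → ℂ) (u : ℂ) :
    Matrix (Fin k) (Fin k) (Matrix (Fin N → Fin k) (Fin N → Fin k) ℂ) :=
  ((List.finRange N).reverse.map fun j => lax k N (u - y j) j).prod

theorem comp_symm_mono (y : Fin N → ℂ) (u : ℂ) :
    (Matrix.compRingEquiv (Fin k) (Fin N → Fin k) ℂ).symm (mono k N y u) =
      monodromy k N y u := by
  rw [mono, map_list_prod, List.ofFn_eq_map, ← List.map_reverse, List.map_map, monodromy]
  simp only [Function.comp_def, comp_symm_R0j]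

theorem transfer_eq_trace (y : Fin N → ℂ) (u : ℂ) :
    transfer k N y u = (monodromy k N y u).trace := by
  ext f g
  rw [← comp_symm_mono, Matrix.trace, Matrix.sum_apply]
  rfl

theorem monodromy_exchange (y : Fin N → ℂ) (u v : ℂ) :
    Exchange (u - v) 2 (monodromy k N y u) (monodromy k N y v) := by
  refine Exchange.list_prod (fun j => ?_) (fun i j hij => lax_commute _ _ hij)
    (List.nodup_reverse.mpr (List.nodup_finRange N))
  have := lax_exchange (k := k) (u - y j) (v - y j) j
  rwa [sub_sub_sub_cancel_right] at this

end SiteOperators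

end RTT

/-- the quantum transfer matrices commute: `t(u) t(v) = t(v) t(u)`. -/
theorem transfer_matrices_commute (k N : ℕ) (hk : 1 ≤ k) (hN : 1 ≤ N)
    (y : Fin N → ℂ) (u v : ℂ) :
    transfer k N y u * transfer k N y v = transfer k N y v * transfer k N y u := by
  rcases eq_or_ne u v with rfl | huv
  · rfl
  · rw [RTT.transfer_eq_trace, RTT.transfer_eq_trace]
    refine (RTT.monodromy_exchange y u v).trace_commute
      (mul_ne_zero two_ne_zero (sub_ne_zero.mpr huv)).isUnit ?_
    rw [neg_sub]
    exact RTT.monodromy_exchange y v u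

end
end

section
/- Determinants of the quantum Jacobi–Trudi form satisfy Hirota's bilinear difference equation: let f : ℤ × ℤ → ℂ be any function and for integers a ≥ 0, s, u define T^a_s(u) := det of the a × a matrix with (i,j)-entry f(s + i − j, u − i − j + a + 1) for 1 ≤ i, j ≤ a (so T⁰_s(u) = 1 as the empty determinant). Then for all a ≥ 1 and all s, u ∈ ℤ: T^a_s(u+1)·T^a_s(u−1) − T^a_{s+1}(u)·T^a_{s−1}(u) = T^{a+1}_s(u)·T^{a−1}_s(u). -/
noncomputable section

/-- The quantum Jacobi–Trudi determinant: for `f : ℤ × ℤ → ℂ` (the one-row transfer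
matrices `T¹_s(u) = f(s,u)`), `T^a_s(u)` is the determinant of the `a × a` matrix with
`(i,j)`-entry `f(s + i − j, u − i − j + a + 1)` for `1 ≤ i, j ≤ a` (here the indices
`i, j : Fin a` are 0-based, whence the shift by `a − 1`). -/
noncomputable def TJT (f : ℤ × ℤ → ℂ) (a : ℕ) (s u : ℤ) : ℂ :=
  Matrix.det (Matrix.of fun i j : Fin a =>
    f (s + ((i : ℕ) : ℤ) - ((j : ℕ) : ℤ),
       u - ((i : ℕ) : ℤ) - ((j : ℕ) : ℤ) + (a : ℤ) - 1))

/-- Laplace expansion along a column supported on the diagonal. -/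
theorem Matrix.det_eq_mul_of_column_diagonal {R : Type*} [CommRing R] {n : ℕ}
    (A : Matrix (Fin (n + 1)) (Fin (n + 1)) R) (j : Fin (n + 1))
    (h : ∀ i, i ≠ j → A i j = 0) :
    A.det = A j j * (A.submatrix j.succAbove j.succAbove).det := by
  rw [Matrix.det_succ_column A j, Finset.sum_eq_single j]
  · rw [Even.neg_one_pow ⟨_, rfl⟩, one_mul]
  · intro i _ hi
    rw [h i hi, mul_zero, zero_mul]
  · simp

/-- The Desnanot–Jacobi identity multiplied by the determinant. -/
theorem Matrix.det_mul_desnanot_jacobi {R : Type*} [CommRing R] {n : ℕ}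
    (M : Matrix (Fin (n + 2)) (Fin (n + 2)) R) :
    M.det * ((M.submatrix Fin.succ Fin.succ).det *
        (M.submatrix Fin.castSucc Fin.castSucc).det -
      (M.submatrix Fin.succ Fin.castSucc).det *
        (M.submatrix Fin.castSucc Fin.succ).det) =
    M.det * (M.det *
      (M.submatrix (fun i : Fin n => i.castSucc.succ) (fun i => i.castSucc.succ)).det) := by
  let p : Fin 2 → Fin (n + 2) := ![0, Fin.last (n + 1)]
  let A : Matrix (Fin (n + 2)) (Fin 2) R :=
    (M.adjugate - 1).submatrix id p
  let B : Matrix (Fin 2) (Fin (n + 2)) R := (1 : Matrix _ _ R).submatrix p id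
  have hlast : Fin.last (n + 1) ≠ 0 := Fin.last_pos.ne'
  have hsign : ((-1 : R) ^ (n + 1)) * (-1) ^ (n + 1) = 1 := by
    rw [← mul_pow]; simp
  have hN : (1 + A * B).det =
      (M.submatrix Fin.succ Fin.succ).det * (M.submatrix Fin.castSucc Fin.castSucc).det -
      (M.submatrix Fin.succ Fin.castSucc).det *
        (M.submatrix Fin.castSucc Fin.succ).det := by
    have hBA : 1 + B * A = M.adjugate.submatrix p p := by
      have : B * A = (M.adjugate - 1).submatrix p p := by
        have := Matrix.submatrix_mul_equiv (1 : Matrix _ _ R) (M.adjugate - 1) p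
          (Equiv.refl _) p
        rw [one_mul] at this
        exact this
      have hp : Function.Injective p := by
        intro i j
        fin_cases i <;> fin_cases j <;> simp [p, hlast, hlast.symm]
      rw [this, Matrix.submatrix_sub, Pi.sub_apply, Pi.sub_apply, Matrix.submatrix_one p hp,
        add_sub_cancel]
    rw [Matrix.det_one_add_mul_comm, hBA, Matrix.det_fin_two]
    simp only [Matrix.submatrix_apply, p, Matrix.cons_val_zero, Matrix.cons_val_one,
      Matrix.adjugate_fin_succ_eq_det_submatrix, Fin.succAbove_zero, Fin.succAbove_last,
      Fin.val_zero, Fin.val_last, add_zero, zero_add, pow_zero, one_mul,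
      pow_add (-1 : R) (n + 1) (n + 1),
      hsign]
    linear_combination (-(M.submatrix Fin.succ Fin.castSucc).det *
      (M.submatrix Fin.castSucc Fin.succ).det) * hsign
  have hMN : ∀ i j : Fin (n + 2), (M * (1 + A * B) : Matrix _ _ R) i j =
      if j = 0 ∨ j = Fin.last (n + 1) then M.det * (1 : Matrix _ _ R) i j else M i j := by
    have hMA : M * A = (M.det • (1 : Matrix _ _ R) - M).submatrix id p := by
      have := Matrix.submatrix_mul_equiv M (M.adjugate - 1) id (Equiv.refl _) p
      rw [Matrix.mul_sub, Matrix.mul_adjugate, mul_one] at this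
      exact this
    intro i j
    have hij : (M * (1 + A * B) : Matrix _ _ R) i j = M i j +
        ((M.det * (1 : Matrix _ _ R) i (0 : Fin (n + 2)) - M i 0) *
            (1 : Matrix _ _ R) (0 : Fin (n + 2)) j +
          (M.det * (1 : Matrix _ _ R) i (Fin.last (n + 1)) - M i (Fin.last (n + 1))) *
            (1 : Matrix _ _ R) (Fin.last (n + 1)) j) := by
      rw [mul_add, mul_one, ← Matrix.mul_assoc, hMA, Matrix.add_apply, Matrix.mul_apply,
        Fin.sum_univ_two]
      rfl
    rw [hij]
    by_cases h0 : j = 0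
    · subst h0
      rw [if_pos (Or.inl rfl), Matrix.one_apply_eq, Matrix.one_apply_ne hlast]
      ring
    · by_cases hl : j = Fin.last (n + 1)
      · subst hl
        rw [if_pos (Or.inr rfl), Matrix.one_apply_eq, Matrix.one_apply_ne hlast.symm]
        ring
      · rw [if_neg (not_or.mpr ⟨h0, hl⟩), Matrix.one_apply_ne (Ne.symm h0),
          Matrix.one_apply_ne (Ne.symm hl)]
        ring
  rw [← hN, ← Matrix.det_mul, Matrix.det_eq_mul_of_column_diagonal _ 0,
    Matrix.det_eq_mul_of_column_diagonal _ (Fin.last n)]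
  · rw [Matrix.submatrix_submatrix]
    simp only [Matrix.submatrix_apply, hMN, Fin.succAbove_zero, Fin.succ_last]
    simp only [true_or, or_true, if_true, Matrix.one_apply_eq, mul_one]
    congr 3
    ext i j
    have h1 : j.castSucc.succ ≠ 0 := Fin.succ_ne_zero _
    have h2 : j.castSucc.succ ≠ Fin.last (n + 1) := by
      rw [← Fin.succ_last]
      exact fun h => (Fin.castSucc_lt_last j).ne (Fin.succ_injective _ h)
    simp only [Matrix.submatrix_apply, Function.comp_apply, Fin.succAbove_last, hMN, h1, h2,
      or_self, if_false]
  · intro i hi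
    have : i.succ ≠ Fin.last (n + 1) := by
      rw [← Fin.succ_last]
      exact fun h => hi (Fin.succ_injective _ h)
    simp [hMN, Matrix.one_apply_ne this]
  · intro i hi
    simp [hMN, Matrix.one_apply_ne hi]

/-- The Desnanot–Jacobi identity. -/
theorem Matrix.desnanot_jacobi {R : Type*} [CommRing R] {n : ℕ}
    (M : Matrix (Fin (n + 2)) (Fin (n + 2)) R) :
    (M.submatrix Fin.succ Fin.succ).det * (M.submatrix Fin.castSucc Fin.castSucc).det -
      (M.submatrix Fin.succ Fin.castSucc).det * (M.submatrix Fin.castSucc Fin.succ).det =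
    M.det *
      (M.submatrix (fun i : Fin n => i.castSucc.succ) (fun i => i.castSucc.succ)).det := by
  let φ : MvPolynomial (Fin (n + 2) × Fin (n + 2)) ℤ →+* R :=
    MvPolynomial.eval₂Hom (Int.castRingHom R) fun q => M q.1 q.2
  let X := Matrix.mvPolynomialX (Fin (n + 2)) (Fin (n + 2)) ℤ
  have hX : φ.mapMatrix X = M := Matrix.mvPolynomialX_map_eval₂ (Int.castRingHom R) M
  have hsub : ∀ {m : ℕ} (e g : Fin m → Fin (n + 2)),
      φ (X.submatrix e g).det = (M.submatrix e g).det := by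
    intro m e g
    rw [RingHom.map_det, ← hX]
    rfl
  have h := congrArg φ
    (mul_left_cancel₀ (Matrix.det_mvPolynomialX_ne_zero (Fin (n + 2)) ℤ)
      (Matrix.det_mul_desnanot_jacobi X))
  simp only [map_sub, map_mul, hsub] at h
  rwa [RingHom.map_det, hX] at h

/-- the quantum Jacobi–Trudi determinants satisfy Hirota's bilinear
difference equation
`T^a_s(u+1) T^a_s(u−1) − T^a_{s+1}(u) T^a_{s−1}(u) = T^{a+1}_s(u) T^{a−1}_s(u)`. -/
theorem jacobi_trudi_hirota (f : ℤ × ℤ → ℂ) :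
    ∀ a : ℕ, 1 ≤ a → ∀ s u : ℤ,
      TJT f a s (u + 1) * TJT f a s (u - 1) - TJT f a (s + 1) u * TJT f a (s - 1) u =
        TJT f (a + 1) s u * TJT f (a - 1) s u := by
  intro a ha s u
  obtain ⟨n, rfl⟩ := Nat.exists_eq_add_of_le' ha
  have h := Matrix.desnanot_jacobi (Matrix.of fun i j : Fin (n + 2) =>
    f (s + ((i : ℕ) : ℤ) - ((j : ℕ) : ℤ),
       u - ((i : ℕ) : ℤ) - ((j : ℕ) : ℤ) + ((n + 2 : ℕ) : ℤ) - 1))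
  rw [mul_comm (TJT f (n + 1) s (u + 1)), Nat.add_sub_cancel]
  unfold TJT
  convert h using 4 <;> first
    | rfl
    | (ext i j
       simp only [Matrix.submatrix_apply, Matrix.of_apply, Fin.val_succ, Fin.val_castSucc]
       congr 2 <;> push_cast <;> ring)

end
end

section
/- (Theorem 3.1, part (i).) Let τ : ℤ³ → ℂ be nowhere zero, with arguments written τ(p,t,u), and let z, w ∈ ℂ. For each (p,t) define difference operators on functions f : ℤ → ℂ by (M^{(z)}_{p,t} f)(u) = f(u+1) − z·[τ(p,t,u)τ(p,t+1,u+1)/(τ(p,t+1,u)τ(p,t,u+1))]·f(u) and (M^{(w)}_{p,t} f)(u) = f(u+1) − w·[τ(p,t,u)τ(p+1,t,u+1)/(τ(p+1,t,u)τ(p,t,u+1))]·f(u). Then the discrete Zakharov–Shabat equation M^{(w)}_{p,t+1} ∘ M^{(z)}_{p,t} = M^{(z)}_{p+1,t} ∘ M^{(w)}_{p,t} holds for all p, t ∈ ℤ (as an identity of operators, i.e. on every f and every u) if and only if there exists a function H₁ : ℤ² → ℂ (independent of u) such that for all p, t, u ∈ ℤ: z·τ(p+1,t,u)τ(p,t+1,u+1)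 − w·τ(p,t+1,u)τ(p+1,t,u+1) + H₁(p,t)·τ(p+1,t+1,u)τ(p,t,u+1) = 0. -/
noncomputable section

/-- The M-operator `M^{(z)}_{p,t}` of the `t`-flow:
`(M^{(z)}_{p,t} f)(u) = f(u+1) − z·[τ(p,t,u)τ(p,t+1,u+1)/(τ(p,t+1,u)τ(p,t,u+1))]·f(u)`. -/
noncomputable def MzOp (τ : ℤ → ℤ → ℤ → ℂ) (z : ℂ) (p t : ℤ) : (ℤ → ℂ) → (ℤ → ℂ) :=
  fun f u => f (u + 1) -
    z * (τ p t u * τ p (t + 1) (u + 1) / (τ p (t + 1) u * τ p t (u + 1))) * f u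

/-- The M-operator `M^{(w)}_{p,t}` of the `p`-flow:
`(M^{(w)}_{p,t} f)(u) = f(u+1) − w·[τ(p,t,u)τ(p+1,t,u+1)/(τ(p+1,t,u)τ(p,t,u+1))]·f(u)`. -/
noncomputable def MwOp (τ : ℤ → ℤ → ℤ → ℂ) (w : ℂ) (p t : ℤ) : (ℤ → ℂ) → (ℤ → ℂ) :=
  fun f u => f (u + 1) -
    w * (τ p t u * τ (p + 1) t (u + 1) / (τ (p + 1) t u * τ p t (u + 1))) * f u

/-- The quotient that must be independent of `u` in the bilinear equation. -/
def bilinearQuotient (τ : ℤ → ℤ → ℤ → ℂ) (z w : ℂ) (p t u : ℤ) : ℂ :=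
  (w * (τ p (t + 1) u * τ (p + 1) t (u + 1)) - z * (τ (p + 1) t u * τ p (t + 1) (u + 1))) /
    (τ (p + 1) (t + 1) u * τ p t (u + 1))

lemma comp_sub_comp_apply (τ : ℤ → ℤ → ℤ → ℂ) (hτ : ∀ p t u : ℤ, τ p t u ≠ 0) (z w : ℂ)
    (p t : ℤ) (f : ℤ → ℂ) (u : ℤ) :
    (MwOp τ w p (t + 1) ∘ MzOp τ z p t) f u - (MzOp τ z (p + 1) t ∘ MwOp τ w p t) f u =
      (bilinearQuotient τ z w p t (u + 1) - bilinearQuotient τ z w p t u) *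
        (τ p t (u + 1) * τ (p + 1) (t + 1) (u + 1) /
          (τ p (t + 1) (u + 1) * τ (p + 1) t (u + 1))) * f (u + 1) := by
  simp only [MwOp, MzOp, bilinearQuotient, Function.comp_apply]
  have ha := hτ p t
  have hb := hτ p (t + 1)
  have hc := hτ (p + 1) t
  have hd := hτ (p + 1) (t + 1)
  generalize τ p t = a at *
  generalize τ p (t + 1) = b at *
  generalize τ (p + 1) t = c at *
  generalize τ (p + 1) (t + 1) = d at *
  have ha₁ := ha (u + 1)
  have ha₂ := ha (u + 1 + 1)
  have hb₀ := hb u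
  have hb₁ := hb (u + 1)
  have hc₀ := hc u
  have hc₁ := hc (u + 1)
  have hd₀ := hd u
  have hd₁ := hd (u + 1)
  field_simp
  ring

lemma comp_eq_comp_iff (τ : ℤ → ℤ → ℤ → ℂ) (hτ : ∀ p t u : ℤ, τ p t u ≠ 0) (z w : ℂ)
    (p t : ℤ) :
    MwOp τ w p (t + 1) ∘ MzOp τ z p t = MzOp τ z (p + 1) t ∘ MwOp τ w p t ↔
      Function.Periodic (bilinearQuotient τ z w p t) 1 := by
  constructor
  · intro h u
    have key := comp_sub_comp_apply τ hτ z w p t (fun _ => 1) u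
    rw [h, sub_self, mul_one] at key
    refine sub_eq_zero.1 ((mul_eq_zero.1 key.symm).resolve_right ?_)
    simp [hτ]
  · intro h
    funext f u
    rw [← sub_eq_zero, comp_sub_comp_apply τ hτ, h u, sub_self, zero_mul, zero_mul]

lemma bilinear_eq_zero_iff (τ : ℤ → ℤ → ℤ → ℂ) (hτ : ∀ p t u : ℤ, τ p t u ≠ 0) (z w H : ℂ)
    (p t u : ℤ) :
    z * (τ (p + 1) t u * τ p (t + 1) (u + 1)) - w * (τ p (t + 1) u * τ (p + 1) t (u + 1)) +
        H * (τ (p + 1) (t + 1) u * τ p t (u + 1)) = 0 ↔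
      bilinearQuotient τ z w p t u = H := by
  rw [bilinearQuotient, div_eq_iff (mul_ne_zero (hτ _ _ _) (hτ _ _ _))]
  constructor <;> intro h <;> linear_combination -h

/-- Theorem 3.1, part (i): the discrete Zakharov–Shabat equation
`M^{(w)}_{p,t+1} ∘ M^{(z)}_{p,t} = M^{(z)}_{p+1,t} ∘ M^{(w)}_{p,t}` holds for all `p, t`
iff there is a function `H₁(p,t)` (independent of `u`) such that
`z τ(p+1,t,u) τ(p,t+1,u+1) − w τ(p,t+1,u) τ(p+1,t,u+1) + H₁(p,t) τ(p+1,t+1,u) τ(p,t,u+1) = 0`. -/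
theorem discrete_zakharov_shabat_i (τ : ℤ → ℤ → ℤ → ℂ)
    (hτ : ∀ p t u : ℤ, τ p t u ≠ 0) (z w : ℂ) :
    (∀ p t : ℤ, MwOp τ w p (t + 1) ∘ MzOp τ z p t = MzOp τ z (p + 1) t ∘ MwOp τ w p t) ↔
      ∃ H₁ : ℤ → ℤ → ℂ, ∀ p t u : ℤ,
        z * (τ (p + 1) t u * τ p (t + 1) (u + 1)) -
          w * (τ p (t + 1) u * τ (p + 1) t (u + 1)) +
          H₁ p t * (τ (p + 1) (t + 1) u * τ p t (u + 1)) = 0 := by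
  simp only [comp_eq_comp_iff τ hτ, bilinear_eq_zero_iff τ hτ]
  constructor
  · intro h
    refine ⟨fun p t => bilinearQuotient τ z w p t 0, fun p t u => ?_⟩
    simpa using (h p t).int_mul_eq u
  · rintro ⟨H, hH⟩ p t u
    rw [hH, hH]

end
end

section
/- (Theorem 3.1, part (iii).) Let τ : ℤ³ → ℂ be nowhere zero, with arguments written τ(t,t̄,u), and let z, z̄ ∈ ℂ with z̄ ≠ 0. For each (t,t̄) define difference operators on functions f : ℤ → ℂ by (M^{(z)}_{t,t̄} f)(u) = f(u+1) − z·[τ(t,t̄,u)τ(t+1,t̄,u+1)/(τ(t+1,t̄,u)τ(t,t̄,u+1))]·f(u) and (M̄^{(z̄)}_{t,t̄} f)(u) = −z̄·f(u) + [τ(t,t̄,u−1)τ(t,t̄+1,u+1)/(τ(t,t̄+1,u)τ(t,t̄,u))]·f(u−1). Then the discrete Zakharov–Shabat equation M̄^{(z̄)}_{t+1,t̄} ∘ M^{(z)}_{t,t̄} = M^{(z)}_{t,t̄+1} ∘ M̄^{(z̄)}_{t,t̄} holds for all t, t̄ ∈ ℤ (as operators on all f : ℤ → ℂ) if and only if there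 exists a function H₃ : ℤ² → ℂ (independent of u) such that for all t, t̄, u ∈ ℤ: z·τ(t,t̄+1,u)τ(t+1,t̄,u) + H₃(t,t̄)·τ(t,t̄,u)τ(t+1,t̄+1,u) = z̄^{−1}·τ(t,t̄+1,u+1)τ(t+1,t̄,u−1). -/
noncomputable section

/-- The M-operator `M^{(z)}_{t,t̄}`:
`(M^{(z)}_{t,t̄} f)(u) = f(u+1) − z·[τ(t,t̄,u)τ(t+1,t̄,u+1)/(τ(t+1,t̄,u)τ(t,t̄,u+1))]·f(u)`. -/
noncomputable def Mz (τ : ℤ → ℤ → ℤ → ℂ) (z : ℂ) (t tb : ℤ) : (ℤ → ℂ) → (ℤ → ℂ) :=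
  fun f u => f (u + 1) -
    z * (τ t tb u * τ (t + 1) tb (u + 1) / (τ (t + 1) tb u * τ t tb (u + 1))) * f u

/-- The barred M-operator `M̄^{(z̄)}_{t,t̄}`:
`(M̄^{(z̄)}_{t,t̄} f)(u) = −z̄ f(u) + [τ(t,t̄,u−1)τ(t,t̄+1,u+1)/(τ(t,t̄+1,u)τ(t,t̄,u))] f(u−1)`. -/
noncomputable def Mbz (τ : ℤ → ℤ → ℤ → ℂ) (zb : ℂ) (t tb : ℤ) : (ℤ → ℂ) → (ℤ → ℂ) :=
  fun f u => -zb * f u +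
    (τ t tb (u - 1) * τ t (tb + 1) (u + 1) / (τ t (tb + 1) u * τ t tb u)) * f (u - 1)

/-- The function of `u` whose constancy is equivalent to the Zakharov–Shabat equation. -/
def zsInvariant (τ : ℤ → ℤ → ℤ → ℂ) (z zb : ℂ) (t tb u : ℤ) : ℂ :=
  (zb⁻¹ * (τ t (tb + 1) (u + 1) * τ (t + 1) tb (u - 1)) -
    z * (τ t (tb + 1) u * τ (t + 1) tb u)) / (τ t tb u * τ (t + 1) (tb + 1) u)

/-- The two sides of the Zakharov–Shabat equation differ by a multiplication operator, whose
coefficient is proportional to the increment of `zsInvariant`. -/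
theorem Mbz_Mz_sub_Mz_Mbz (τ : ℤ → ℤ → ℤ → ℂ) (hτ : ∀ t tb u : ℤ, τ t tb u ≠ 0)
    (z zb : ℂ) (hzb : zb ≠ 0) (t tb : ℤ) (f : ℤ → ℂ) (u : ℤ) :
    Mbz τ zb (t + 1) tb (Mz τ z t tb f) u - Mz τ z t (tb + 1) (Mbz τ zb t tb f) u =
      zb * (τ t tb u * τ (t + 1) (tb + 1) (u + 1) / (τ t (tb + 1) (u + 1) * τ (t + 1) tb u)) *
        (zsInvariant τ z zb t tb u - zsInvariant τ z zb t tb (u + 1)) * f u := by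
  have h₁ := hτ t tb u
  have h₂ := hτ t tb (u + 1)
  have h₃ := hτ (t + 1) tb u
  have h₄ := hτ (t + 1) tb (u - 1)
  have h₅ := hτ t (tb + 1) u
  have h₆ := hτ t (tb + 1) (u + 1)
  have h₇ := hτ (t + 1) (tb + 1) u
  have h₈ := hτ (t + 1) (tb + 1) (u + 1)
  simp only [Mbz, Mz, zsInvariant, add_sub_cancel_right, sub_add_cancel]
  field_simp
  ring

theorem Mbz_comp_Mz_eq_iff (τ : ℤ → ℤ → ℤ → ℂ) (hτ : ∀ t tb u : ℤ, τ t tb u ≠ 0)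
    (z zb : ℂ) (hzb : zb ≠ 0) (t tb : ℤ) :
    Mbz τ zb (t + 1) tb ∘ Mz τ z t tb = Mz τ z t (tb + 1) ∘ Mbz τ zb t tb ↔
      Function.Periodic (zsInvariant τ z zb t tb) 1 := by
  constructor
  · intro h u
    have key := Mbz_Mz_sub_Mz_Mbz τ hτ z zb hzb t tb 1 u
    have h1 := congrFun (congrFun h 1) u
    simp only [Function.comp_apply] at h1
    rw [h1, sub_self] at key
    symm
    simpa [hzb, hτ, sub_eq_zero] using key.symm
  · intro h
    funext f u
    rw [Function.comp_apply, Function.comp_apply, ← sub_eq_zero,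
      Mbz_Mz_sub_Mz_Mbz τ hτ z zb hzb t tb f u, h u]
    ring

theorem bilinear_iff_zsInvariant_eq (τ : ℤ → ℤ → ℤ → ℂ) (hτ : ∀ t tb u : ℤ, τ t tb u ≠ 0)
    (z zb H : ℂ) (t tb u : ℤ) :
    z * (τ t (tb + 1) u * τ (t + 1) tb u) + H * (τ t tb u * τ (t + 1) (tb + 1) u) =
      zb⁻¹ * (τ t (tb + 1) (u + 1) * τ (t + 1) tb (u - 1)) ↔
      zsInvariant τ z zb t tb u = H := by
  rw [zsInvariant, div_eq_iff (mul_ne_zero (hτ _ _ _) (hτ _ _ _)), sub_eq_iff_eq_add', eq_comm]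

/-- Theorem 3.1, part (iii): the discrete Zakharov–Shabat equation
`M̄^{(z̄)}_{t+1,t̄} ∘ M^{(z)}_{t,t̄} = M^{(z)}_{t,t̄+1} ∘ M̄^{(z̄)}_{t,t̄}` holds for all
`t, t̄` iff there is `H₃(t,t̄)` (independent of `u`) with
`z τ(t,t̄+1,u) τ(t+1,t̄,u) + H₃(t,t̄) τ(t,t̄,u) τ(t+1,t̄+1,u)
  = z̄⁻¹ τ(t,t̄+1,u+1) τ(t+1,t̄,u−1)`. -/
theorem discrete_zakharov_shabat_iii (τ : ℤ → ℤ → ℤ → ℂ)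
    (hτ : ∀ t tb u : ℤ, τ t tb u ≠ 0) (z zb : ℂ) (hzb : zb ≠ 0) :
    (∀ t tb : ℤ, Mbz τ zb (t + 1) tb ∘ Mz τ z t tb = Mz τ z t (tb + 1) ∘ Mbz τ zb t tb) ↔
      ∃ H₃ : ℤ → ℤ → ℂ, ∀ t tb u : ℤ,
        z * (τ t (tb + 1) u * τ (t + 1) tb u) +
          H₃ t tb * (τ t tb u * τ (t + 1) (tb + 1) u) =
          zb⁻¹ * (τ t (tb + 1) (u + 1) * τ (t + 1) tb (u - 1)) := by
  simp only [Mbz_comp_Mz_eq_iff τ hτ z zb hzb, bilinear_iff_zsInvariant_eq τ hτ]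
  constructor
  · intro h
    refine ⟨fun t tb => zsInvariant τ z zb t tb 0, fun t tb u => ?_⟩
    simpa using (h t tb).int_mul u 0
  · rintro ⟨H, hH⟩ t tb u
    rw [hH, hH]

end
end

section
/- Solutions of Hirota's bilinear difference equation satisfy the Y-system: let T : ℤ³ → ℂ be nowhere zero and satisfy T(x₁+1,x₂,x₃)T(x₁−1,x₂,x₃) − T(x₁,x₂+1,x₃)T(x₁,x₂−1,x₃) + T(x₁,x₂,x₃+1)T(x₁,x₂,x₃−1) = 0 for all x ∈ ℤ³, and define Y(x₁,x₂,x₃) := T(x₁,x₂,x₃+1)T(x₁,x₂,x₃−1)/(T(x₁+1,x₂,x₃)T(x₁−1,x₂,x₃)). Then Y is nowhere zero, 1 + Y(x₁±1, x₂, x₃)^{-1} ≠ 0 at every point, and for all x ∈ ℤ³: Y(x₁,x₂+1,x₃)·Y(x₁,x₂−1,x₃) = (1+Y(x₁,x₂,x₃+1))(1+Y(x₁,x₂,x₃−1)) / ((1+Y(x₁+1,x₂,x₃)^{-1})(1+Y(x₁−1,x₂,x₃)^{-1})). -/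
noncomputable section

/-- The gauge invariant quantity
`Y(x₁,x₂,x₃) = T(x₁,x₂,x₃+1)T(x₁,x₂,x₃−1)/(T(x₁+1,x₂,x₃)T(x₁−1,x₂,x₃))`. -/
noncomputable def Yof (T : ℤ → ℤ → ℤ → ℂ) : ℤ → ℤ → ℤ → ℂ :=
  fun x₁ x₂ x₃ =>
    T x₁ x₂ (x₃ + 1) * T x₁ x₂ (x₃ - 1) / (T (x₁ + 1) x₂ x₃ * T (x₁ - 1) x₂ x₃)

/-- On a nowhere-vanishing Hirota solution, `1 + Y` factors as a ratio of products of `T`. -/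
theorem one_add_Yof {T : ℤ → ℤ → ℤ → ℂ} (hT : ∀ x₁ x₂ x₃ : ℤ, T x₁ x₂ x₃ ≠ 0)
    (hH : ∀ x₁ x₂ x₃ : ℤ,
      T (x₁ + 1) x₂ x₃ * T (x₁ - 1) x₂ x₃ - T x₁ (x₂ + 1) x₃ * T x₁ (x₂ - 1) x₃ +
        T x₁ x₂ (x₃ + 1) * T x₁ x₂ (x₃ - 1) = 0) (x₁ x₂ x₃ : ℤ) :
    1 + Yof T x₁ x₂ x₃ =
      T x₁ (x₂ + 1) x₃ * T x₁ (x₂ - 1) x₃ / (T (x₁ + 1) x₂ x₃ * T (x₁ - 1) x₂ x₃) := by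
  have h := mul_ne_zero (hT (x₁ + 1) x₂ x₃) (hT (x₁ - 1) x₂ x₃)
  rw [Yof, eq_div_iff h, add_mul, div_mul_cancel₀ _ h]
  linear_combination hH x₁ x₂ x₃

/-- On a nowhere-vanishing Hirota solution, `1 + Y⁻¹` factors as a ratio of products of `T`. -/
theorem one_add_Yof_inv {T : ℤ → ℤ → ℤ → ℂ} (hT : ∀ x₁ x₂ x₃ : ℤ, T x₁ x₂ x₃ ≠ 0)
    (hH : ∀ x₁ x₂ x₃ : ℤ,
      T (x₁ + 1) x₂ x₃ * T (x₁ - 1) x₂ x₃ - T x₁ (x₂ + 1) x₃ * T x₁ (x₂ - 1) x₃ +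
        T x₁ x₂ (x₃ + 1) * T x₁ x₂ (x₃ - 1) = 0) (x₁ x₂ x₃ : ℤ) :
    1 + (Yof T x₁ x₂ x₃)⁻¹ =
      T x₁ (x₂ + 1) x₃ * T x₁ (x₂ - 1) x₃ / (T x₁ x₂ (x₃ + 1) * T x₁ x₂ (x₃ - 1)) := by
  have h := mul_ne_zero (hT x₁ x₂ (x₃ + 1)) (hT x₁ x₂ (x₃ - 1))
  rw [Yof, inv_div, eq_div_iff h, add_mul, div_mul_cancel₀ _ h]
  linear_combination hH x₁ x₂ x₃

/-- nowhere-vanishing solutions of Hirota's bilinear difference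
equation satisfy the Y-system. -/
theorem hirota_Y_system (T : ℤ → ℤ → ℤ → ℂ) (hT : ∀ x₁ x₂ x₃ : ℤ, T x₁ x₂ x₃ ≠ 0)
    (hH : ∀ x₁ x₂ x₃ : ℤ,
      T (x₁ + 1) x₂ x₃ * T (x₁ - 1) x₂ x₃ - T x₁ (x₂ + 1) x₃ * T x₁ (x₂ - 1) x₃ +
        T x₁ x₂ (x₃ + 1) * T x₁ x₂ (x₃ - 1) = 0) :
    (∀ x₁ x₂ x₃ : ℤ, Yof T x₁ x₂ x₃ ≠ 0) ∧
    (∀ x₁ x₂ x₃ : ℤ, 1 + (Yof T x₁ x₂ x₃)⁻¹ ≠ 0) ∧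
    (∀ x₁ x₂ x₃ : ℤ,
      Yof T x₁ (x₂ + 1) x₃ * Yof T x₁ (x₂ - 1) x₃ =
        (1 + Yof T x₁ x₂ (x₃ + 1)) * (1 + Yof T x₁ x₂ (x₃ - 1)) /
          ((1 + (Yof T (x₁ + 1) x₂ x₃)⁻¹) * (1 + (Yof T (x₁ - 1) x₂ x₃)⁻¹))) := by
  refine ⟨fun x₁ x₂ x₃ => by simp [Yof, hT], fun x₁ x₂ x₃ => ?_, fun x₁ x₂ x₃ => ?_⟩
  · rw [one_add_Yof_inv hT hH]
    simp [hT]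
  · rw [one_add_Yof hT hH, one_add_Yof hT hH, one_add_Yof_inv hT hH, one_add_Yof_inv hT hH]
    simp only [Yof]
    field_simp [hT]

end
end

section
/- The quantum determinant formula satisfies the discrete d'Alembert equation: let k ≥ 1 and let φ : ℤ → ℂ be any function. For integers s ≥ 0 and u ∈ ℤ define T^k_s(u) := ∏_{p=0}^{s−1} [ φ(u−s+k+2+2p) · ∏_{l=1}^{k−1} φ(u−s−k+2p+2l) ] (with T^k_0(u) = 1 as the empty product). Then for all s ≥ 1 and all u ∈ ℤ: T^k_s(u+1)·T^k_s(u−1) = T^k_{s+1}(u)·T^k_{s−1}(u). -/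
noncomputable section

/-- The explicit product formula for the quantum determinant:
`T^k_s(u) = ∏_{p=0}^{s−1} [ φ(u−s+k+2+2p) ∏_{l=1}^{k−1} φ(u−s−k+2p+2l) ]`. -/
noncomputable def Tkdet (k : ℕ) (φ : ℤ → ℂ) (s : ℕ) (u : ℤ) : ℂ :=
  ∏ p ∈ Finset.range s,
    (φ (u - (s : ℤ) + (k : ℤ) + 2 + 2 * (p : ℤ)) *
      ∏ l ∈ Finset.Icc 1 (k - 1), φ (u - (s : ℤ) - (k : ℤ) + 2 * (p : ℤ) + 2 * (l : ℤ)))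

/-- The outermost factor of the product can be split off, shifting the spectral parameter. -/
theorem Tkdet_succ (k : ℕ) (φ : ℤ → ℂ) (s : ℕ) (u : ℤ) :
    Tkdet k φ (s + 1) u = Tkdet k φ s (u - 1) *
      (φ (u + s + k + 1) * ∏ l ∈ Finset.Icc 1 (k - 1), φ (u + s - 1 - k + 2 * (l : ℤ))) := by
  unfold Tkdet
  rw [Finset.prod_range_succ]
  push_cast
  congr 1
  · refine Finset.prod_congr rfl fun p _ => ?_
    congr 1
    · congr 1; ring
    · refine Finset.prod_congr rfl fun l _ => ?_
      congr 1; ring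
  · congr 1
    · congr 1; ring
    · refine Finset.prod_congr rfl fun l _ => ?_
      congr 1; ring

/-- the quantum determinant formula satisfies the discrete
d'Alembert equation `T^k_s(u+1) T^k_s(u−1) = T^k_{s+1}(u) T^k_{s−1}(u)`. -/
theorem qdet_dAlembert (k : ℕ) (hk : 1 ≤ k) (φ : ℤ → ℂ) :
    ∀ s : ℕ, 1 ≤ s → ∀ u : ℤ,
      Tkdet k φ s (u + 1) * Tkdet k φ s (u - 1) =
        Tkdet k φ (s + 1) u * Tkdet k φ (s - 1) u := by
  intro s hs u
  obtain ⟨t, rfl⟩ := Nat.exists_eq_add_of_le' hs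
  rw [Tkdet_succ k φ t (u + 1), Tkdet_succ k φ (t + 1) u, Nat.add_sub_cancel, add_sub_cancel_right]
  push_cast
  rw [show u + 1 + (t : ℤ) = u + (t + 1) by ring]
  ring

end
end

section
/- Every nowhere-vanishing solution of the discrete d'Alembert equation factorizes into light-cone functions: if g : ℤ × ℤ → ℂ satisfies g(u,s) ≠ 0 for all (u,s) and g(u+1,s)·g(u−1,s) = g(u,s+1)·g(u,s−1) for all (u,s) ∈ ℤ², then there exist functions χ₊, χ₋ : ℤ → ℂ such that g(u,s) = χ₊(u+s)·χ₋(u−s) for all (u,s) ∈ ℤ². -/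
noncomputable section

/-- A function on `ℤ` invariant under the unit shift is constant. -/
theorem Int.apply_eq_apply_zero_of_forall_add_one {α : Type*} {f : ℤ → α}
    (hf : ∀ n, f (n + 1) = f n) (n : ℤ) :
    f n = f 0 := by
  simpa using Function.Periodic.int_mul_eq (f := f) (c := 1) hf n

/-- A nowhere-vanishing function on `ℤ × ℤ` whose adjacent `2 × 2` minors all vanish
has rank one. -/
theorem mul_zero_zero_of_adjacent_minors {K : Type*} [Field K] {F : ℤ → ℤ → K}
    (h0 : ∀ m n, F m n ≠ 0)
    (hF : ∀ m n, F (m + 1) (n + 1) * F m n = F (m + 1) n * F m (n + 1)) (m n : ℤ) :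
    F m n * F 0 0 = F m 0 * F 0 n := by
  have ratio_const (m n : ℤ) : F (m + 1) n / F m n = F (m + 1) 0 / F m 0 := by
    refine Int.apply_eq_apply_zero_of_forall_add_one (f := fun n => F (m + 1) n / F m n) (fun n => ?_) n
    exact (div_eq_div_iff (h0 _ _) (h0 _ _)).2 (hF m n)
  have quotient_const : F m n / F m 0 = F 0 n / F 0 0 := by
    refine Int.apply_eq_apply_zero_of_forall_add_one (f := fun m => F m n / F m 0) (fun m => ?_) m
    have := (div_eq_div_iff (h0 _ _) (h0 _ _)).1 (ratio_const m n)
    rw [div_eq_div_iff (h0 _ _) (h0 _ _), this, mul_comm]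
  rw [(div_eq_div_iff (h0 _ _) (h0 _ _)).1 quotient_const, mul_comm]

/-- every nowhere-vanishing solution of the discrete d'Alembert
equation `g(u+1,s)g(u−1,s) = g(u,s+1)g(u,s−1)` factorizes into light-cone functions:
`g(u,s) = χ₊(u+s) χ₋(u−s)`. -/
theorem dAlembert_factorization (g : ℤ → ℤ → ℂ)
    (h0 : ∀ u s : ℤ, g u s ≠ 0)
    (hd : ∀ u s : ℤ, g (u + 1) s * g (u - 1) s = g u (s + 1) * g u (s - 1)) :
    ∃ χp χm : ℤ → ℂ, ∀ u s : ℤ, g u s = χp (u + s) * χm (u - s) := by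
  have rank_one (e m n : ℤ) :
      g (m + n + e) (m - n) * g e 0 = g (m + e) m * g (n + e) (-n) := by
    have minors (m n : ℤ) :
        g (m + 1 + (n + 1) + e) (m + 1 - (n + 1)) * g (m + n + e) (m - n) =
          g (m + 1 + n + e) (m + 1 - n) * g (m + (n + 1) + e) (m - (n + 1)) := by
      convert hd (m + n + e + 1) (m - n) using 3 <;> ring
    simpa using mul_zero_zero_of_adjacent_minors (F := fun m n => g (m + n + e) (m - n))
      (fun _ _ => h0 _ _) minors m n
  refine ⟨fun a => g (a / 2 + a % 2) (a / 2),
    fun b => g (b / 2 + b % 2) (-(b / 2)) / g (b % 2) 0, fun u s => ?_⟩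
  have parity : (u + s) % 2 = (u - s) % 2 := by omega
  have hu : (u + s) / 2 + (u - s) / 2 + (u - s) % 2 = u := by omega
  have hs : (u + s) / 2 - (u - s) / 2 = s := by omega
  have key := rank_one ((u - s) % 2) ((u + s) / 2) ((u - s) / 2)
  rw [hu, hs] at key
  simp only [parity]
  rw [← mul_div_assoc, eq_div_iff (h0 _ _), key]

end
end

section
/- Baxter's T–Q relation follows from the auxiliary linear problem of the A₁ case: let T : ℤ × ℤ → ℂ (written T_s(u) with s the first argument), and let Q, φ : ℤ → ℂ with Q(u) ≠ 0 for all u ∈ ℤ. Assume that for all s, u ∈ ℤ: T_{s+1}(u)·Q(u−s) − T_s(u+1)·Q(u−s−2) = φ(u−s)·Q(u+s+2), and that the boundary condition T_{−1}(u) = 0 holds for all u ∈ ℤ. Then for all u ∈ ℤ: φ(u)·Q(u+2) + φ(u+2)·Q(u−2) = T_1(u)·Q(u). -/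
noncomputable section

/-- Baxter's T–Q relation from the auxiliary linear problem of the
`A₁` case. Here `T s u` denotes `T¹_s(u)`, `Q` is Baxter's Q-function and `φ` the
boundary polynomial. -/
theorem baxter_TQ_relation (T : ℤ → ℤ → ℂ) (Q φ : ℤ → ℂ)
    (hQ : ∀ u : ℤ, Q u ≠ 0)
    (hlin : ∀ s u : ℤ,
      T (s + 1) u * Q (u - s) - T s (u + 1) * Q (u - s - 2) = φ (u - s) * Q (u + s + 2))
    (hbc : ∀ u : ℤ, T (-1) u = 0) :
    ∀ u : ℤ, φ u * Q (u + 2) + φ (u + 2) * Q (u - 2) = T 1 u * Q u := by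
  intro u
  have hT0 : T 0 (u + 1) = φ (u + 2) := by
    have h := hlin (-1) (u + 1)
    rw [hbc, show (-1 : ℤ) + 1 = 0 by ring, show u + 1 - -1 = u + 2 by ring,
      show u + 1 + -1 + 2 = u + 2 by ring, zero_mul, sub_zero] at h
    exact mul_right_cancel₀ (hQ (u + 2)) h
  have h := hlin 0 u
  rw [zero_add, sub_zero, add_zero, hT0] at h
  linear_combination -h

end
end
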